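/- arXiv:2007.12141 — 3 statements merged into one kernel-verified Lean document; each statement's English description precedes it below -/
import Mathlib

section
/- Let (𝒳,F,h) and (𝒳̄,F̄,h̄) be two state-space systems with the same input set 𝒵 and output set 𝒴 that both have the echo state property and yield the same input/output system, i.e. H^F_h = H^{F̄}_{h̄}. If (𝒳,F,h) is strongly reachable and (𝒳̄,F̄,h̄) is observable, then there exists a unique system morphism f : 𝒳 → 𝒳̄; it is determined by f(H^F(z)) = H^{F̄}(z) for all z ∈ 𝒵^{ℤ₋}. -/
/-!
Semi-infinite sequences `z : ℤ₋ → α` are encoded as `ℕ → α` via `n ↦ z_{-n}`.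
-/

/-- Concatenation `z z̃` of `z ∈ α^{ℤ₋}` with a finite word `z̃ = (z̃_1, …, z̃_T)`. -/
def concat {α : Type*} (z : ℕ → α) {T : ℕ} (w : Fin T → α) : ℕ → α := fun n =>
  if h : n < T then w ⟨T - 1 - n, by omega⟩ else z (n - T)

/-- `x` is a solution of the state system with state map `F` for the input `z`. -/
def IsSolution {X Z : Type*} (F : X → Z → X) (z : ℕ → Z) (x : ℕ → X) : Prop :=
  ∀ n : ℕ, x n = F (x (n + 1)) (z n)

/-- Echo state property: every input has exactly one solution. -/
def ESP {X Z : Type*} (F : X → Z → X) : Prop :=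
  ∀ z : ℕ → Z, ∃! x : ℕ → X, IsSolution F z x

/-- `f` is a morphism of state-space systems: system equivariant and readout invariant. -/
def IsMorphism {X₁ X₂ Z Y : Type*} (F₁ : X₁ → Z → X₁) (h₁ : X₁ → Y)
    (F₂ : X₂ → Z → X₂) (h₂ : X₂ → Y) (f : X₁ → X₂) : Prop :=
  (∀ (x : X₁) (z : Z), f (F₁ x z) = F₂ (f x) z) ∧ ∀ x : X₁, h₁ x = h₂ (f x)

theorem concat_add {α : Type*} (z : ℕ → α) {T : ℕ} (w : Fin T → α) (n : ℕ) :
    concat z w (n + T) = z n := by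
  simp [concat]

theorem IsSolution.comp {X X' Z : Type*} {F : X → Z → X} {F' : X' → Z → X'} {f : X → X'}
    (hf : ∀ x z, f (F x z) = F' (f x) z) {z : ℕ → Z} {x : ℕ → X} (hx : IsSolution F z x) :
    IsSolution F' z (fun n => f (x n)) := fun n => by
  rw [← hf, ← hx n]

/-- Under the echo state property, the solution for `concat z w` extends the one for `z`. -/
theorem solution_concat_add {X Z : Type*} {F : X → Z → X} (hE : ESP F)
    {U : (ℕ → Z) → ℕ → X} (hU : ∀ z : ℕ → Z, IsSolution F z (U z))
    (z : ℕ → Z) {T : ℕ} (w : Fin T → Z) (n : ℕ) : U (concat z w) (n + T) = U z n := by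
  have hs : IsSolution F z (fun n => U (concat z w) (n + T)) := fun n => by
    have := hU (concat z w) (n + T)
    rw [concat_add] at this
    simpa only [Nat.add_right_comm] using this
  exact congrFun ((hE z).unique hs (hU z)) n

theorem solution_concat_singleton {X Z : Type*} {F : X → Z → X} (hE : ESP F)
    {U : (ℕ → Z) → ℕ → X} (hU : ∀ z : ℕ → Z, IsSolution F z (U z)) (z : ℕ → Z) (a : Z) :
    U (concat z (fun _ : Fin 1 => a)) 0 = F (U z 0) a := by
  rw [hU _ 0, solution_concat_add hE hU z (fun _ : Fin 1 => a) 0]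
  simp [concat]

/-- The terminal state for `concat z w` depends on `z` only through its terminal state. -/
theorem solution_concat_zero_congr {X Z : Type*} {F : X → Z → X} (hE : ESP F)
    {U : (ℕ → Z) → ℕ → X} (hU : ∀ z : ℕ → Z, IsSolution F z (U z)) {z₁ z₂ : ℕ → Z}
    (hz : U z₁ 0 = U z₂ 0) {T : ℕ} (w : Fin T → Z) :
    U (concat z₁ w) 0 = U (concat z₂ w) 0 := by
  suffices key : ∀ k n, n + k = T → U (concat z₁ w) n = U (concat z₂ w) n from
    key T 0 (Nat.zero_add T)
  intro k
  induction k with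
  | zero =>
    intro n hn
    obtain rfl : n = T := hn
    have e₁ := solution_concat_add hE hU z₁ w 0
    have e₂ := solution_concat_add hE hU z₂ w 0
    rw [Nat.zero_add] at e₁ e₂
    rw [e₁, e₂, hz]
  | succ k ih =>
    intro n hn
    have hlt : n < T := by omega
    rw [hU _ n, hU (concat z₂ w) n, ih (n + 1) (by omega)]
    simp [concat, hlt]

/-- if both systems have the ESP (with solution maps `U`, `U'`), realize the
same input/output system, `(X,F,h)` is strongly reachable and `(X',F',h')` is observable,
then there is a unique system morphism `f : X → X'`, determined by `f (H^F z) = H^{F'} z`. -/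
theorem stmt3 {X X' Z Y : Type*} (F : X → Z → X) (h : X → Y)
    (F' : X' → Z → X') (h' : X' → Y)
    (hE : ESP F) (hE' : ESP F')
    (U : (ℕ → Z) → ℕ → X) (hU : ∀ z : ℕ → Z, IsSolution F z (U z))
    (U' : (ℕ → Z) → ℕ → X') (hU' : ∀ z : ℕ → Z, IsSolution F' z (U' z))
    (hsame : ∀ z : ℕ → Z, h (U z 0) = h' (U' z 0))
    (hreach : ∀ x : X, ∃ z : ℕ → Z, U z 0 = x)
    (hobs : ∀ z₁ z₂ : ℕ → Z,
      (∀ (T : ℕ) (w : Fin T → Z), h' (U' (concat z₁ w) 0) = h' (U' (concat z₂ w) 0)) →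
      U' z₁ 0 = U' z₂ 0) :
    (∃! f : X → X', IsMorphism F h F' h' f) ∧
      ∀ f : X → X', IsMorphism F h F' h' f → ∀ z : ℕ → Z, f (U z 0) = U' z 0 := by
  have determined : ∀ f : X → X', IsMorphism F h F' h' f → ∀ z, f (U z 0) = U' z 0 :=
    fun f hf z => congrFun ((hE' z).unique ((hU z).comp hf.1) (hU' z)) 0
  have factors : ∀ z₁ z₂, U z₁ 0 = U z₂ 0 → U' z₁ 0 = U' z₂ 0 := fun z₁ z₂ hz =>
    hobs z₁ z₂ fun T w => by
      rw [← hsame, ← hsame, solution_concat_zero_congr hE hU hz w]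
  choose g hg using hreach
  have hf : ∀ z, U' (g (U z 0)) 0 = U' z 0 := fun z => factors _ _ (hg _)
  refine ⟨⟨fun x => U' (g x) 0, ⟨fun x a => ?_, fun x => ?_⟩, fun f hm => ?_⟩, determined⟩
  · have := hf (concat (g x) (fun _ : Fin 1 => a))
    rwa [solution_concat_singleton hE hU, solution_concat_singleton hE' hU', hg] at this
  · rw [← hsame, hg]
  · funext x
    rw [← determined f hm, hg]
end

section
/- Let N ∈ ℕ, A an N×N real matrix with spectral radius ρ(A) < 1, and C ∈ ℝ^N. Then for every z ∈ ℓ∞₋(ℝ) and every t ∈ ℤ₋ the series x_t := Σ_{j=0}^∞ A^j C z_{t−j} converges, the resulting sequence x belongs to ℓ∞₋(ℝ^N), it satisfies x_t = A x_{t−1} + C z_t for all t ∈ ℤ₋, and it is the unique solution of this state equation in ℓ∞₋(ℝ^N). In particular, the linear state equation has the (ℓ∞₋(ℝ^N), ℓ∞₋(ℝ))-echo state property. -/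
open Matrix

/-!
Semi-infinite sequences `z : ℤ₋ → α` are encoded as `ℕ → α` via `n ↦ z_{-n}`; the state
equation `x_t = A x_{t-1} + C z_t` then reads `x n = A.mulVec (x (n+1)) + z n • C`.
The spectral radius of a real matrix is the `spectralRadius` of its complexification.
-/

/-- A sequence is bounded, i.e. belongs to `ℓ∞₋`. -/
def BddSeq {E : Type*} [Norm E] (z : ℕ → E) : Prop := ∃ M : ℝ, ∀ n : ℕ, ‖z n‖ ≤ M

open Filter Topology

/-- In a complex Banach algebra, the powers of an element of spectral radius less than one
have summable norms. -/
theorem summable_norm_pow_of_spectralRadius_lt_one {B : Type*} [NormedRing B] [NormedAlgebra ℂ B]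
    [CompleteSpace B] (a : B) (ha : spectralRadius ℂ a < 1) : Summable fun n : ℕ => ‖a ^ n‖ := by
  obtain ⟨r, har, hr1⟩ := ENNReal.lt_iff_exists_nnreal_btwn.1 ha
  have hr : r < 1 := by exact_mod_cast hr1
  have hev := (spectrum.pow_nnnorm_pow_one_div_tendsto_nhds_spectralRadius a).eventually_lt_const har
  refine Summable.of_norm_bounded_eventually_nat
    (summable_geometric_of_lt_one r.2 (by exact_mod_cast hr)) ?_
  filter_upwards [hev, eventually_gt_atTop 0] with n hn hpos
  have hn0 : (n : ℝ) ≠ 0 := by exact_mod_cast hpos.ne'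
  have h := ENNReal.rpow_le_rpow hn.le (Nat.cast_nonneg n : (0 : ℝ) ≤ n)
  rw [← ENNReal.rpow_mul, one_div_mul_cancel hn0, ENNReal.rpow_one, ENNReal.rpow_natCast] at h
  rw [norm_norm]
  exact_mod_cast h

section LinftyOp

attribute [local instance] Matrix.linftyOpNormedRing Matrix.linftyOpNormedAlgebra

theorem Matrix.linfty_opNorm_map_algebraMap {n : Type*} [Fintype n] [DecidableEq n]
    (A : Matrix n n ℝ) : ‖A.map (algebraMap ℝ ℂ)‖ = ‖A‖ := by
  simp [Matrix.linfty_opNorm_def]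

theorem Matrix.exists_summable_norm_pow_mulVec_le {n : Type*} [Fintype n] [DecidableEq n]
    (A : Matrix n n ℝ) (hA : spectralRadius ℂ (A.map (algebraMap ℝ ℂ)) < 1) :
    ∃ b : ℕ → ℝ, Summable b ∧ (∀ k, 0 ≤ b k) ∧ ∀ k v, ‖(A ^ k).mulVec v‖ ≤ b k * ‖v‖ := by
  refine ⟨fun k => ‖A ^ k‖, ?_, fun k => norm_nonneg _, fun k v => Matrix.linfty_opNorm_mulVec _ _⟩
  refine (summable_norm_pow_of_spectralRadius_lt_one _ hA).congr fun k => ?_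
  rw [← Matrix.map_pow, Matrix.linfty_opNorm_map_algebraMap]

end LinftyOp

section StateEquation

variable {n : Type*} [Fintype n] [DecidableEq n] {A : Matrix n n ℝ} {b : ℕ → ℝ}

theorem summable_smul_pow_mulVec (hb : Summable b) (hle : ∀ k v, ‖(A ^ k).mulVec v‖ ≤ b k * ‖v‖)
    {z : ℕ → ℝ} {M : ℝ} (hz : ∀ n, ‖z n‖ ≤ M) (C : n → ℝ) (t : ℕ) :
    (Summable fun j : ℕ => z (t + j) • (A ^ j).mulVec C) ∧
      ‖∑' j : ℕ, z (t + j) • (A ^ j).mulVec C‖ ≤ ∑' j, M * (b j * ‖C‖) := by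
  have hs : Summable fun j => M * (b j * ‖C‖) := (hb.mul_right _).mul_left _
  have hbound : ∀ j, ‖z (t + j) • (A ^ j).mulVec C‖ ≤ M * (b j * ‖C‖) := fun j => by
    rw [norm_smul]
    exact mul_le_mul (hz _) (hle j C) (norm_nonneg _) ((norm_nonneg _).trans (hz 0))
  exact ⟨.of_norm_bounded hs hbound, tsum_of_norm_bounded hs.hasSum hbound⟩

theorem tsum_smul_pow_mulVec_eq {z : ℕ → ℝ} {C : n → ℝ}
    (hs : ∀ t, Summable fun j : ℕ => z (t + j) • (A ^ j).mulVec C) (t : ℕ) :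
    (∑' j : ℕ, z (t + j) • (A ^ j).mulVec C)
      = A.mulVec (∑' j : ℕ, z (t + 1 + j) • (A ^ j).mulVec C) + z t • C := by
  have hmap := (Matrix.mulVecLin A).toContinuousLinearMap.map_tsum (hs (t + 1))
  simp only [LinearMap.coe_toContinuousLinearMap', Matrix.mulVecLin_apply] at hmap
  rw [(hs t).tsum_eq_zero_add, hmap, add_comm]
  congr 1
  · refine tsum_congr fun j => ?_
    rw [Matrix.mulVec_smul, Matrix.mulVec_mulVec, ← pow_succ', add_right_comm, add_assoc]
  · simp

theorem eq_of_bddSeq_of_state_eq (hb : Summable b)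
    (hb0 : ∀ k, 0 ≤ b k) (hle : ∀ k v, ‖(A ^ k).mulVec v‖ ≤ b k * ‖v‖) {u x y : ℕ → n → ℝ}
    (hx : BddSeq x) (hy : BddSeq y) (hxA : ∀ t, x t = A.mulVec (x (t + 1)) + u t)
    (hyA : ∀ t, y t = A.mulVec (y (t + 1)) + u t) : x = y := by
  obtain ⟨M, hM⟩ := hx
  obtain ⟨L, hL⟩ := hy
  funext t
  have hiter : ∀ k, x t - y t = (A ^ k).mulVec (x (t + k) - y (t + k)) := fun k => by
    induction k with
    | zero => simp
    | succ k ih =>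
      rw [ih, hxA (t + k), hyA (t + k), add_sub_add_right_eq_sub, ← Matrix.mulVec_sub,
        Matrix.mulVec_mulVec, ← pow_succ, add_assoc]
  have hlim : Tendsto (fun k => b k * (M + L)) atTop (𝓝 0) := by
    simpa using hb.tendsto_atTop_zero.mul_const (M + L)
  have hnorm : ‖x t - y t‖ ≤ 0 := ge_of_tendsto' hlim fun k => by
    rw [hiter k]
    refine (hle k _).trans (mul_le_mul_of_nonneg_left ?_ (hb0 k))
    exact (norm_sub_le _ _).trans (add_le_add (hM _) (hL _))
  exact sub_eq_zero.1 (norm_le_zero_iff.1 hnorm)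

end StateEquation

/-- if `ρ(A) < 1` then for every bounded input `z` the series
`x_t = Σ_{j≥0} A^j C z_{t-j}` converges, defines a bounded sequence solving
`x_t = A x_{t-1} + C z_t`, and this is the unique bounded solution; in particular the
linear state equation has the `(ℓ∞₋(ℝ^N), ℓ∞₋(ℝ))`-echo state property. -/
theorem stmt13 (N : ℕ) (A : Matrix (Fin N) (Fin N) ℝ)
    (hA : spectralRadius ℂ (A.map (algebraMap ℝ ℂ)) < 1) (C : Fin N → ℝ) :
    (∀ z : ℕ → ℝ, BddSeq z →
      (∀ n : ℕ, Summable fun j : ℕ => z (n + j) • (A ^ j).mulVec C) ∧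
      BddSeq (fun n : ℕ => ∑' j : ℕ, z (n + j) • (A ^ j).mulVec C) ∧
      (∀ n : ℕ, (∑' j : ℕ, z (n + j) • (A ^ j).mulVec C)
          = A.mulVec (∑' j : ℕ, z (n + 1 + j) • (A ^ j).mulVec C) + z n • C) ∧
      (∀ x : ℕ → Fin N → ℝ, BddSeq x →
        (∀ n : ℕ, x n = A.mulVec (x (n + 1)) + z n • C) →
        ∀ n : ℕ, x n = ∑' j : ℕ, z (n + j) • (A ^ j).mulVec C)) ∧
    (∀ z : ℕ → ℝ, BddSeq z →
      ∃! x : ℕ → Fin N → ℝ,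
        BddSeq x ∧ ∀ n : ℕ, x n = A.mulVec (x (n + 1)) + z n • C) := by
  obtain ⟨b, hb, hb0, hle⟩ := A.exists_summable_norm_pow_mulVec_le hA
  have hseries : ∀ z : ℕ → ℝ, BddSeq z →
      (∀ n : ℕ, Summable fun j : ℕ => z (n + j) • (A ^ j).mulVec C) ∧
      BddSeq (fun n : ℕ => ∑' j : ℕ, z (n + j) • (A ^ j).mulVec C) := fun z ⟨M, hM⟩ =>
    ⟨fun n => (summable_smul_pow_mulVec hb hle hM C n).1,
      _, fun n => (summable_smul_pow_mulVec hb hle hM C n).2⟩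
  refine ⟨fun z hz => ?_, fun z hz => ?_⟩ <;> obtain ⟨hs, hbdd⟩ := hseries z hz
  · exact ⟨hs, hbdd, tsum_smul_pow_mulVec_eq hs, fun x hx hxA =>
      congrFun (eq_of_bddSeq_of_state_eq hb hb0 hle hx hbdd hxA (tsum_smul_pow_mulVec_eq hs))⟩
  · exact ⟨_, ⟨hbdd, tsum_smul_pow_mulVec_eq hs⟩, fun x hx =>
      eq_of_bddSeq_of_state_eq hb hb0 hle hx.1 hbdd hx.2 (tsum_smul_pow_mulVec_eq hs)⟩
end

section
/- Let N ∈ ℕ, A an N×N real matrix with spectral radius ρ(A) ≥ 1, and C ∈ ℝ^N. Then the linear state equation x_t = A x_{t−1} + C z_t fails the (ℓ∞₋(ℝ^N), ℓ∞₋(ℝ))-echo state property: for the zero input z = 0 there exists a nonzero bounded solution x ∈ ℓ∞₋(ℝ^N) with x_t = A x_{t−1} for all t ∈ ℤ₋, in addition to the zero solution. -/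
open Matrix

section Spectrum

attribute [local instance] Matrix.linftyOpNormedRing Matrix.linftyOpNormedAlgebra

/-- A complex matrix with spectral radius at least one has an eigenvector whose eigenvalue has
modulus at least one. -/
theorem exists_mulVec_eq_smul_of_one_le_spectralRadius {N : ℕ} (B : Matrix (Fin N) (Fin N) ℂ)
    (hB : 1 ≤ spectralRadius ℂ B) :
    ∃ (k : ℂ) (v : Fin N → ℂ), 1 ≤ ‖k‖ ∧ v ≠ 0 ∧ B *ᵥ v = k • v := by
  have hne : (spectrum ℂ B).Nonempty := by
    by_contra h
    rw [Set.not_nonempty_iff_eq_empty] at h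
    simp [spectralRadius, h] at hB
  obtain ⟨k, hk, hkB⟩ := spectrum.exists_nnnorm_eq_spectralRadius_of_nonempty hne
  rw [← hkB] at hB
  rw [← Matrix.spectrum_toLin', ← Module.End.hasEigenvalue_iff_mem_spectrum] at hk
  obtain ⟨v, hv⟩ := hk.exists_hasEigenvector
  refine ⟨k, v, by exact_mod_cast hB, hv.2, ?_⟩
  simpa using hv.apply_eq_smul

end Spectrum

/-- Taking real parts commutes with the action of a real matrix. -/
theorem re_map_mulVec {N : ℕ} (A : Matrix (Fin N) (Fin N) ℝ) (v : Fin N → ℂ) (i : Fin N) :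
    (((A.map (algebraMap ℝ ℂ)) *ᵥ v) i).re = (A *ᵥ fun j => (v j).re) i := by
  simp [Matrix.mulVec, dotProduct]

/-- A real matrix with spectral radius at least one admits a nonzero bounded backward orbit. -/
theorem exists_bddSeq_mulVec_ne_zero {N : ℕ} (A : Matrix (Fin N) (Fin N) ℝ)
    (hA : 1 ≤ spectralRadius ℂ (A.map (algebraMap ℝ ℂ))) :
    ∃ x : ℕ → Fin N → ℝ,
      BddSeq x ∧ (∀ n : ℕ, x n = A.mulVec (x (n + 1))) ∧ x ≠ fun _ _ => 0 := by
  obtain ⟨k, v, hk, hv, hkv⟩ := exists_mulVec_eq_smul_of_one_le_spectralRadius _ hA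
  obtain ⟨i, hi⟩ := Function.ne_iff.1 hv
  have hk0 : k ≠ 0 := norm_pos_iff.1 (one_pos.trans_le hk)
  let w : ℕ → Fin N → ℂ := fun n => (star (v i) * (k ^ n)⁻¹) • v
  refine ⟨fun n j => (w n j).re, ⟨‖v i‖ * ‖v‖, fun n => ?_⟩, fun n => ?_, fun h => ?_⟩
  · refine (pi_norm_le_iff_of_nonneg (by positivity)).2 fun j => ?_
    refine (Complex.abs_re_le_norm _).trans ?_
    simp only [w, Pi.smul_apply, smul_eq_mul, norm_mul, norm_star, norm_inv, norm_pow]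
    gcongr
    · exact mul_le_of_le_one_right (norm_nonneg _) (inv_le_one_of_one_le₀ (one_le_pow₀ hk))
    · exact norm_le_pi_norm v j
  · have hw : w n = (A.map (algebraMap ℝ ℂ)) *ᵥ w (n + 1) := by
      simp only [w, Matrix.mulVec_smul, hkv, smul_smul]
      congr 1
      field_simp
      ring
    ext j
    rw [← re_map_mulVec, ← hw]
  · have h0 : (star (v i) * v i).re = 0 := by
      simpa [w] using congrFun (congrFun h 0) i
    rw [Complex.star_def, ← Complex.normSq_eq_conj_mul_self, Complex.ofReal_re] at h0
    exact hi (Complex.normSq_eq_zero.1 h0)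

/-- if `ρ(A) ≥ 1` then the linear state equation fails the
`(ℓ∞₋(ℝ^N), ℓ∞₋(ℝ))`-echo state property: for the zero input there is a nonzero bounded
solution of `x_t = A x_{t-1}` in addition to the zero solution. -/
theorem stmt14 (N : ℕ) (A : Matrix (Fin N) (Fin N) ℝ)
    (hA : 1 ≤ spectralRadius ℂ (A.map (algebraMap ℝ ℂ))) (C : Fin N → ℝ) :
    (∃ x : ℕ → Fin N → ℝ,
      BddSeq x ∧ (∀ n : ℕ, x n = A.mulVec (x (n + 1))) ∧ x ≠ fun _ _ => 0) ∧
    ¬ (∀ z : ℕ → ℝ, BddSeq z →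
        ∃! x : ℕ → Fin N → ℝ,
          BddSeq x ∧ ∀ n : ℕ, x n = A.mulVec (x (n + 1)) + z n • C) := by
  obtain ⟨x, hx, hxA, hx0⟩ := exists_bddSeq_mulVec_ne_zero A hA
  refine ⟨⟨x, hx, hxA, hx0⟩, fun h => hx0 ?_⟩
  refine (h (fun _ => 0) ⟨0, by simp⟩).unique ⟨hx, by simpa using hxA⟩ ⟨⟨0, fun n => ?_⟩, fun n => ?_⟩
  · exact (pi_norm_le_iff_of_nonneg le_rfl).2 (by simp)
  · ext j
    simp [Matrix.mulVec, dotProduct]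
end
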